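/- arXiv:2506.06307 — 2 statements merged into one kernel-verified Lean document; each statement's English description precedes it below -/
import Mathlib

section
/- In Corner the Two Rooks, every legal move from a position in 𝒫 = ({(x,y,z,w) : x ⊕ y ⊕ z ⊕ w = 0} ∪ 𝒫₁) − 𝒩₀ leads to a position outside 𝒫. -/
/-- Moves of "Corner the Two Rooks": a position `(x, y, z, w)` records the squares
`(x, y)` and `(z, w)` of the two rooks; a move strictly decreases exactly one
coordinate of exactly one rook (jumping over the other rook is allowed), and the two
rooks may never occupy the same square. -/
def RookMove : ℕ × ℕ × ℕ × ℕ → ℕ × ℕ × ℕ × ℕ → Prop :=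
  fun (x, y, z, w) (x', y', z', w') =>
    (x', y') ≠ (z', w') ∧
      (((z', w') = (z, w) ∧ ((y' = y ∧ x' < x) ∨ (x' = x ∧ y' < y))) ∨
        ((x', y') = (x, y) ∧ ((w' = w ∧ z' < z) ∨ (z' = z ∧ w' < w))))

/-- `𝒫₁ = {(2n,m,2n+1,m)} ∪ {(2n+1,m,2n,m)} ∪ {(n,2m+1,n,2m)} ∪ {(n,2m,n,2m+1)}`,
with `n, m` ranging over the nonnegative integers. -/
def calP1 : Set (ℕ × ℕ × ℕ × ℕ) :=
  {p | ∃ n m : ℕ, p = (2 * n, m, 2 * n + 1, m)} ∪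
  {p | ∃ n m : ℕ, p = (2 * n + 1, m, 2 * n, m)} ∪
  {p | ∃ n m : ℕ, p = (n, 2 * m + 1, n, 2 * m)} ∪
  {p | ∃ n m : ℕ, p = (n, 2 * m, n, 2 * m + 1)}

/-- `𝒩₀ = {(2n,2m,2n+1,2m+1)} ∪ {(2n+1,2m+1,2n,2m)} ∪ {(2n+1,2m,2n,2m+1)} ∪
{(2n,2m+1,2n+1,2m)}`, with `n, m` ranging over the nonnegative integers. -/
def calN0 : Set (ℕ × ℕ × ℕ × ℕ) :=
  {p | ∃ n m : ℕ, p = (2 * n, 2 * m, 2 * n + 1, 2 * m + 1)} ∪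
  {p | ∃ n m : ℕ, p = (2 * n + 1, 2 * m + 1, 2 * n, 2 * m)} ∪
  {p | ∃ n m : ℕ, p = (2 * n + 1, 2 * m, 2 * n, 2 * m + 1)} ∪
  {p | ∃ n m : ℕ, p = (2 * n, 2 * m + 1, 2 * n + 1, 2 * m)}

/-- `𝒫 = ({(x,y,z,w) : x ⊕ y ⊕ z ⊕ w = 0} ∪ 𝒫₁) − 𝒩₀`. -/
def calP : Set (ℕ × ℕ × ℕ × ℕ) :=
  ({p | p.1 ^^^ p.2.1 ^^^ p.2.2.1 ^^^ p.2.2.2 = 0} ∪ calP1) \ calN0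

theorem xor_eq_ite_of_mem_calP {x y z w : ℕ} (hne : (x, y) ≠ (z, w))
    (h : (x, y, z, w) ∈ calP) :
    x ^^^ y ^^^ z ^^^ w = if x / 2 = z / 2 ∧ y / 2 = w / 2 then 1 else 0 := by
  have succ_eq (n : ℕ) : 2 * n + 1 = 2 * n ^^^ 1 := by
    rw [Nat.xor_one_of_even (even_two_mul n)]
  obtain ⟨h0 | h1, hN⟩ := h
  · change x ^^^ y ^^^ z ^^^ w = 0 at h0
    rw [h0, if_neg]
    rintro ⟨hxz, hyw⟩
    by_cases hy : y = w
    · subst hy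
      have hx : x = z := by
        rw [← Nat.xor_eq_zero_iff, ← h0, Nat.xor_right_comm x y z, Nat.xor_xor_cancel_right]
      exact hne (by rw [hx])
    by_cases hx : x = z
    · subst hx
      rw [Nat.xor_right_comm x y x, Nat.xor_self, Nat.zero_xor, Nat.xor_eq_zero_iff] at h0
      exact hy h0
    apply hN
    simp only [calN0, Set.mem_union, Set.mem_ofPred_eq, Prod.mk.injEq]
    rcases Nat.mod_two_eq_zero_or_one x with hx2 | hx2 <;>
    rcases Nat.mod_two_eq_zero_or_one y with hy2 | hy2
    · exact .inl (.inl (.inl ⟨x / 2, y / 2, by omega⟩))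
    · exact .inr ⟨x / 2, y / 2, by omega⟩
    · exact .inl (.inr ⟨x / 2, y / 2, by omega⟩)
    · exact .inl (.inl (.inr ⟨x / 2, y / 2, by omega⟩))
  · simp only [calP1, Set.mem_union, Set.mem_ofPred_eq, Prod.mk.injEq] at h1
    rw [if_pos (by obtain ((⟨n, m, h⟩ | ⟨n, m, h⟩) | ⟨n, m, h⟩) | ⟨n, m, h⟩ := h1 <;> omega)]
    obtain ((⟨n, m, rfl, rfl, rfl, rfl⟩ | ⟨n, m, rfl, rfl, rfl, rfl⟩) |
      ⟨n, m, rfl, rfl, rfl, rfl⟩) | ⟨n, m, rfl, rfl, rfl, rfl⟩ := h1 <;>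
    simp only [succ_eq] <;> grind

theorem xor_div_two_eq_zero_of_mem_calP {x y z w : ℕ} (hne : (x, y) ≠ (z, w))
    (h : (x, y, z, w) ∈ calP) :
    x / 2 ^^^ y / 2 ^^^ z / 2 ^^^ w / 2 = 0 := by
  rw [← Nat.xor_div_two, ← Nat.xor_div_two, ← Nat.xor_div_two, xor_eq_ite_of_mem_calP hne h]
  split_ifs <;> rfl

/-- In Corner the Two Rooks, every legal move from a position in
`𝒫 = ({(x,y,z,w) : x ⊕ y ⊕ z ⊕ w = 0} ∪ 𝒫₁) − 𝒩₀` leads to a position outside `𝒫`. -/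
theorem move_from_calP_leaves_calP (p q : ℕ × ℕ × ℕ × ℕ)
    (hp : (p.1, p.2.1) ≠ (p.2.2.1, p.2.2.2))
    (hpP : p ∈ calP) (hmove : RookMove p q) :
    q ∉ calP := by
  intro hqP
  obtain ⟨x, y, z, w⟩ := p
  obtain ⟨x', y', z', w'⟩ := q
  obtain ⟨hq, hmove⟩ := hmove
  have hhalf := (xor_div_two_eq_zero_of_mem_calP hp hpP).trans
    (xor_div_two_eq_zero_of_mem_calP hq hqP).symm
  have hxor := xor_eq_ite_of_mem_calP hp hpP
  have hxor' := xor_eq_ite_of_mem_calP hq hqP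
  simp only [Prod.mk.injEq] at hmove
  obtain ⟨⟨rfl, rfl⟩, ⟨rfl, hlt⟩ | ⟨rfl, hlt⟩⟩ | ⟨⟨rfl, rfl⟩, ⟨rfl, hlt⟩ | ⟨rfl, hlt⟩⟩ := hmove <;>
  · simp only [Nat.xor_left_inj, Nat.xor_right_inj] at hhalf
    rw [hhalf, ← hxor'] at hxor
    simp only [Nat.xor_left_inj, Nat.xor_right_inj] at hxor
    exact hlt.ne' hxor
end

section
/- In Corner the Two Rooks, from every position in 𝒩 = ({(x,y,z,w) : x ⊕ y ⊕ z ⊕ w ≠ 0} ∪ 𝒩₀) − 𝒫₁ there exists a legal move to a position in 𝒫 = ({(x,y,z,w) : x ⊕ y ⊕ z ⊕ w = 0} ∪ 𝒫₁) − 𝒩₀. -/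
/-- `𝒩 = ({(x,y,z,w) : x ⊕ y ⊕ z ⊕ w ≠ 0} ∪ 𝒩₀) − 𝒫₁`. -/
def calN : Set (ℕ × ℕ × ℕ × ℕ) :=
  ({p | p.1 ^^^ p.2.1 ^^^ p.2.2.1 ^^^ p.2.2.2 ≠ 0} ∪ calN0) \ calP1

theorem mem_calP1_iff (x y z w : ℕ) :
    (x, y, z, w) ∈ calP1 ↔
      (y = w ∧ x ≠ z ∧ x / 2 = z / 2) ∨ (x = z ∧ y ≠ w ∧ y / 2 = w / 2) := by
  simp only [calP1, Set.mem_union, Set.mem_ofPred_eq, Prod.mk.injEq]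
  constructor
  · rintro (((⟨n, m, h⟩ | ⟨n, m, h⟩) | ⟨n, m, h⟩) | ⟨n, m, h⟩) <;> omega
  · rintro (⟨h₁, h₂, h₃⟩ | ⟨h₁, h₂, h₃⟩)
    · rcases Nat.lt_or_gt_of_ne h₂ with h | h
      · exact .inl (.inl (.inl ⟨x / 2, y, by omega⟩))
      · exact .inl (.inl (.inr ⟨x / 2, y, by omega⟩))
    · rcases Nat.lt_or_gt_of_ne h₂ with h | h
      · exact .inr ⟨x, y / 2, by omega⟩
      · exact .inl (.inr ⟨x, y / 2, by omega⟩)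

theorem mem_calN0_iff (x y z w : ℕ) :
    (x, y, z, w) ∈ calN0 ↔ x ≠ z ∧ y ≠ w ∧ x / 2 = z / 2 ∧ y / 2 = w / 2 := by
  simp only [calN0, Set.mem_union, Set.mem_ofPred_eq, Prod.mk.injEq]
  constructor
  · rintro (((⟨n, m, h⟩ | ⟨n, m, h⟩) | ⟨n, m, h⟩) | ⟨n, m, h⟩) <;> omega
  · rintro ⟨h₁, h₂, h₃, h₄⟩
    rcases Nat.lt_or_gt_of_ne h₁ with h | h <;> rcases Nat.lt_or_gt_of_ne h₂ with h' | h'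
    · exact .inl (.inl (.inl ⟨x / 2, y / 2, by omega⟩))
    · exact .inr ⟨x / 2, y / 2, by omega⟩
    · exact .inl (.inr ⟨x / 2, y / 2, by omega⟩)
    · exact .inl (.inl (.inr ⟨x / 2, y / 2, by omega⟩))

theorem mem_calP_iff (x y z w : ℕ) :
    (x, y, z, w) ∈ calP ↔
      (x ^^^ y ^^^ z ^^^ w = 0 ∨ (x, y, z, w) ∈ calP1) ∧ (x, y, z, w) ∉ calN0 :=
  Iff.rfl

theorem transpose_mem_calP1 {x y z w : ℕ} : (y, x, w, z) ∈ calP1 ↔ (x, y, z, w) ∈ calP1 := by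
  simp only [mem_calP1_iff]
  omega

theorem swap_mem_calP1 {x y z w : ℕ} : (z, w, x, y) ∈ calP1 ↔ (x, y, z, w) ∈ calP1 := by
  simp only [mem_calP1_iff]
  omega

theorem transpose_mem_calP {x y z w : ℕ} : (y, x, w, z) ∈ calP ↔ (x, y, z, w) ∈ calP := by
  have h : y ^^^ x ^^^ w ^^^ z = x ^^^ y ^^^ z ^^^ w := by ac_rfl
  rw [mem_calP_iff, mem_calP_iff, h, transpose_mem_calP1]
  refine and_congr_right fun _ => ?_
  simp only [mem_calN0_iff]
  omega

theorem swap_mem_calP {x y z w : ℕ} : (z, w, x, y) ∈ calP ↔ (x, y, z, w) ∈ calP := by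
  have h : z ^^^ w ^^^ x ^^^ y = x ^^^ y ^^^ z ^^^ w := by ac_rfl
  rw [mem_calP_iff, mem_calP_iff, h, swap_mem_calP1]
  refine and_congr_right fun _ => ?_
  simp only [mem_calN0_iff]
  omega

/-- If the nim move on the first coordinate decreases it, then some decrease of that coordinate
legally reaches `calP`: when the nim move itself is illegal or lands in `calN0`, one can move
into `calP1` instead. -/
theorem exists_lt_mem_calP {x y z w : ℕ} (hP1 : (x, y, z, w) ∉ calP1)
    (hlt : y ^^^ z ^^^ w < x) :
    ∃ a < x, (a, y) ≠ (z, w) ∧ (a, y, z, w) ∈ calP := by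
  set s := y ^^^ z ^^^ w with hs
  have hxor : s ^^^ y ^^^ z ^^^ w = 0 := by
    rw [Nat.xor_assoc, Nat.xor_assoc, ← Nat.xor_assoc y, ← hs, Nat.xor_self]
  rw [mem_calP1_iff] at hP1
  by_cases hclose : s / 2 = z / 2 ∧ y / 2 = w / 2 ∧ (s ≠ z ↔ y ≠ w)
  · by_cases hyw : y = w
    · refine ⟨4 * (z / 2) + 1 - z, by omega, by simp only [ne_eq, Prod.mk.injEq]; omega, ?_⟩
      rw [mem_calP_iff, mem_calP1_iff, mem_calN0_iff]
      omega
    · refine ⟨z, by omega, by simp only [ne_eq, Prod.mk.injEq]; omega, ?_⟩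
      rw [mem_calP_iff, mem_calP1_iff, mem_calN0_iff]
      omega
  · refine ⟨s, hlt, by simp only [ne_eq, Prod.mk.injEq]; omega, ?_⟩
    rw [mem_calP_iff, mem_calN0_iff]
    exact ⟨.inl hxor, by omega⟩

/-- In Corner the Two Rooks, from every position in
`𝒩 = ({(x,y,z,w) : x ⊕ y ⊕ z ⊕ w ≠ 0} ∪ 𝒩₀) − 𝒫₁` there exists a legal move to a
position in `𝒫 = ({(x,y,z,w) : x ⊕ y ⊕ z ⊕ w = 0} ∪ 𝒫₁) − 𝒩₀`. -/
theorem move_from_calN_to_calP (p : ℕ × ℕ × ℕ × ℕ)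
    (hp : (p.1, p.2.1) ≠ (p.2.2.1, p.2.2.2))
    (hpN : p ∈ calN) :
    ∃ q, RookMove p q ∧ q ∈ calP := by
  obtain ⟨x, y, z, w⟩ := p
  obtain ⟨hN | hN, hP1⟩ := hpN
  · replace hN : x ^^^ y ^^^ (z ^^^ w) ≠ 0 := by
      rw [← Nat.xor_assoc]
      exact hN
    rcases Nat.xor_trichotomy hN with h | h | h
    · rw [← Nat.xor_assoc] at h
      obtain ⟨a, ha, hd, hq⟩ := exists_lt_mem_calP hP1 h
      exact ⟨(a, y, z, w), ⟨hd, .inl ⟨rfl, .inl ⟨rfl, ha⟩⟩⟩, hq⟩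
    · replace h : x ^^^ w ^^^ z < y := lt_of_eq_of_lt (by ac_rfl) h
      obtain ⟨a, ha, hd, hq⟩ := exists_lt_mem_calP (mt transpose_mem_calP1.1 hP1) h
      refine ⟨(x, a, z, w), ⟨?_, .inl ⟨rfl, .inr ⟨rfl, ha⟩⟩⟩, transpose_mem_calP.1 hq⟩
      simp only [ne_eq, Prod.mk.injEq] at hd ⊢
      omega
    rcases Nat.lt_xor_cases h with h | h
    · replace h : w ^^^ x ^^^ y < z := lt_of_eq_of_lt (by ac_rfl) h
      obtain ⟨a, ha, hd, hq⟩ := exists_lt_mem_calP (mt swap_mem_calP1.1 hP1) h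
      exact ⟨(x, y, a, w), ⟨hd.symm, .inr ⟨rfl, .inl ⟨rfl, ha⟩⟩⟩, swap_mem_calP.1 hq⟩
    · replace h : z ^^^ y ^^^ x < w := lt_of_eq_of_lt (by ac_rfl) h
      obtain ⟨a, ha, hd, hq⟩ := exists_lt_mem_calP
        (mt transpose_mem_calP1.1 (mt swap_mem_calP1.1 hP1)) h
      refine ⟨(x, y, z, a), ⟨?_, .inr ⟨rfl, .inr ⟨rfl, ha⟩⟩⟩,
        swap_mem_calP.1 (transpose_mem_calP.1 hq)⟩
      simp only [ne_eq, Prod.mk.injEq] at hd ⊢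
      omega
  · rw [mem_calN0_iff] at hN
    obtain ⟨hxz, hyw, -, hyw2⟩ := hN
    rcases Nat.lt_or_gt_of_ne hxz with h | h
    · refine ⟨(x, y, x, w), ⟨by simpa using hyw, .inr ⟨rfl, .inl ⟨rfl, h⟩⟩⟩, ?_⟩
      rw [mem_calP_iff, mem_calP1_iff, mem_calN0_iff]
      omega
    · refine ⟨(z, y, z, w), ⟨by simpa using hyw, .inl ⟨rfl, .inl ⟨rfl, h⟩⟩⟩, ?_⟩
      rw [mem_calP_iff, mem_calP1_iff, mem_calN0_iff]
      omega
end
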